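/- Let m, n ≥ 0 and let (A, B) be a pair with A ∈ Mat_{n×m}(ℂ), B ∈ Mat_{m×n}(ℂ) such that the product B A is nilpotent. Then there exist g₁ ∈ GL_m(ℂ), g₂ ∈ GL_n(ℂ) and a decorated bipartition γ ∈ DP(m,n) such that (g₂ A g₁⁻¹, g₁ B g₂⁻¹) is the direct sum, over the decorated pairs occurring in γ (with multiplicity), of the corresponding elementary pairs E_{k,k−1}, E_{k−1,k}, E⁺_{k,k}, E⁻_{k,k}. Moreover γ is uniquely determined: if the direct sums of elementary pairs attached to γ, γ′ ∈ DP(m,n) lie in the same (GL_m(ℂ) × GL_n(ℂ))-orbit for the action (g₁, g₂)·(A, B) = (g₂ A g₁⁻¹, g₁ B g₂⁻¹), then γ = γ′. Consequently γ ↦ orbit of its direct sum is a bijection from DP(m,n) onto the set of (GL_m(ℂ) × GL_n(ℂ))-orbits of pairs (A, B) with B A nilpotent. -/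

import Mathlib

open Matrix
open scoped MatrixGroups

/-- A decorated pair of non-negative integers: `AB j` encodes the pair `(j+1, j)`
(type `(k, k-1)` with `k = j+1`), `BA j` encodes `(j, j+1)` (type `(k-1, k)`),
`P j` encodes `(j+1, j+1)⁺` and `M j` encodes `(j+1, j+1)⁻`. -/
inductive DPair : Type
  | AB : ℕ → DPair
  | BA : ℕ → DPair
  | P : ℕ → DPair
  | M : ℕ → DPair
deriving DecidableEq

namespace DPair

/-- The first coordinate of a decorated pair. -/
def a : DPair → ℕ
  | AB j => j + 1
  | BA j => j
  | P j => j + 1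
  | M j => j + 1

/-- The second coordinate of a decorated pair. -/
def b : DPair → ℕ
  | AB j => j
  | BA j => j + 1
  | P j => j + 1
  | M j => j + 1

end DPair

/-- The `a × b` matrix with `1`s on the main diagonal (entries `(i,i)`) and `0`
elsewhere. -/
def diagOne (a b : ℕ) : Matrix (Fin a) (Fin b) ℂ :=
  fun i j => if (i : ℕ) = (j : ℕ) then 1 else 0

/-- The `a × b` matrix with `1`s on the subdiagonal (entries `(i+1,i)`) and `0`
elsewhere. -/
def subDiag (a b : ℕ) : Matrix (Fin a) (Fin b) ℂ :=
  fun i j => if (i : ℕ) = (j : ℕ) + 1 then 1 else 0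

/-- The first matrix `A` of the elementary pair attached to a decorated pair. -/
def elemA : (p : DPair) → Matrix (Fin p.b) (Fin p.a) ℂ
  | .AB _ => diagOne _ _
  | .BA _ => subDiag _ _
  | .P _ => diagOne _ _
  | .M _ => subDiag _ _

/-- The second matrix `B` of the elementary pair attached to a decorated pair. -/
def elemB : (p : DPair) → Matrix (Fin p.a) (Fin p.b) ℂ
  | .AB _ => subDiag _ _
  | .BA _ => diagOne _ _
  | .P _ => subDiag _ _
  | .M _ => diagOne _ _

/-- Block-diagonal direct sum of two rectangular matrices. -/
def dsum {b₁ a₁ b₂ a₂ : ℕ} (M₁ : Matrix (Fin b₁) (Fin a₁) ℂ)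
    (M₂ : Matrix (Fin b₂) (Fin a₂) ℂ) :
    Matrix (Fin (b₁ + b₂)) (Fin (a₁ + a₂)) ℂ :=
  Matrix.reindex finSumFinEquiv finSumFinEquiv (Matrix.fromBlocks M₁ 0 0 M₂)

/-- The direct sum, over a list of decorated pairs, of the first matrices of the
corresponding elementary pairs. -/
def listA : (l : List DPair) → Matrix (Fin (l.map DPair.b).sum) (Fin (l.map DPair.a).sum) ℂ
  | [] => 0
  | p :: t => dsum (elemA p) (listA t)

/-- The direct sum, over a list of decorated pairs, of the second matrices of the
corresponding elementary pairs. -/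
def listB : (l : List DPair) → Matrix (Fin (l.map DPair.a).sum) (Fin (l.map DPair.b).sum) ℂ
  | [] => 0
  | p :: t => dsum (elemB p) (listB t)

/-- Recasting a matrix along equalities of its dimensions. -/
def castMat {r c r' c' : ℕ} (hr : r = r') (hc : c = c') (M : Matrix (Fin r) (Fin c) ℂ) :
    Matrix (Fin r') (Fin c') ℂ :=
  Matrix.reindex (finCongr hr) (finCongr hc) M

/-- `(A', B')` lies in the `GL_m(ℂ) × GL_n(ℂ)`-orbit of `(A, B)` for the action
`(g₁, g₂) · (A, B) = (g₂ A g₁⁻¹, g₁ B g₂⁻¹)`. -/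
def SameOrbit (m n : ℕ) (A : Matrix (Fin n) (Fin m) ℂ) (B : Matrix (Fin m) (Fin n) ℂ)
    (A' : Matrix (Fin n) (Fin m) ℂ) (B' : Matrix (Fin m) (Fin n) ℂ) : Prop :=
  ∃ (g₁ : GL (Fin m) ℂ) (g₂ : GL (Fin n) ℂ),
    A' = (↑g₂ : Matrix (Fin n) (Fin n) ℂ) * A * (↑(g₁⁻¹) : Matrix (Fin m) (Fin m) ℂ) ∧
    B' = (↑g₁ : Matrix (Fin m) (Fin m) ℂ) * B * (↑(g₂⁻¹) : Matrix (Fin n) (Fin n) ℂ)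


/-! ### Direct sums of matrices -/

/-- Coordinate vectors of length `a + b` are pairs of coordinate vectors. -/
def splitEquiv (a b : ℕ) : (Fin (a + b) → ℂ) ≃ₗ[ℂ] (Fin a → ℂ) × (Fin b → ℂ) :=
  (LinearEquiv.funCongrLeft ℂ ℂ finSumFinEquiv).trans
    (LinearEquiv.sumArrowLequivProdArrow (Fin a) (Fin b) ℂ ℂ)

lemma splitEquiv_dsum_mulVec {b₁ a₁ b₂ a₂ : ℕ} (M₁ : Matrix (Fin b₁) (Fin a₁) ℂ)
    (M₂ : Matrix (Fin b₂) (Fin a₂) ℂ) (x : Fin (a₁ + a₂) → ℂ) :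
    splitEquiv b₁ b₂ (dsum M₁ M₂ *ᵥ x) =
      (M₁ *ᵥ (splitEquiv a₁ a₂ x).1, M₂ *ᵥ (splitEquiv a₁ a₂ x).2) := by
  ext i <;>
  simp [splitEquiv, dsum, Matrix.mulVec, dotProduct, Fin.sum_univ_add,
    LinearMap.funLeft_apply, LinearEquiv.sumArrowLequivProdArrow]

lemma dsum_mul {b₁ a₁ b₂ a₂ c₁ c₂ : ℕ} (M₁ : Matrix (Fin b₁) (Fin a₁) ℂ)
    (M₂ : Matrix (Fin b₂) (Fin a₂) ℂ) (N₁ : Matrix (Fin a₁) (Fin c₁) ℂ)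
    (N₂ : Matrix (Fin a₂) (Fin c₂) ℂ) :
    dsum M₁ M₂ * dsum N₁ N₂ = dsum (M₁ * N₁) (M₂ * N₂) := by
  simp [dsum, Matrix.fromBlocks_multiply]

lemma dsum_one (a b : ℕ) :
    dsum (1 : Matrix (Fin a) (Fin a) ℂ) (1 : Matrix (Fin b) (Fin b) ℂ) = 1 := by
  simp [dsum]

lemma dsum_pow {a b : ℕ} (M : Matrix (Fin a) (Fin a) ℂ) (N : Matrix (Fin b) (Fin b) ℂ) (i : ℕ) :
    dsum M N ^ i = dsum (M ^ i) (N ^ i) := by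
  induction i with
  | zero => simp [dsum_one]
  | succ i ih => rw [pow_succ, ih, dsum_mul, ← pow_succ, ← pow_succ]

lemma finrank_submodule_prod {V W : Type*} [AddCommGroup V] [Module ℂ V] [AddCommGroup W]
    [Module ℂ W] [FiniteDimensional ℂ V] [FiniteDimensional ℂ W]
    (p : Submodule ℂ V) (q : Submodule ℂ W) :
    Module.finrank ℂ (p.prod q) = Module.finrank ℂ p + Module.finrank ℂ q := by
  rw [← Module.finrank_prod]
  refine LinearEquiv.finrank_eq (R := ℂ)
    { toFun := fun x => (⟨x.1.1, x.2.1⟩, ⟨x.1.2, x.2.2⟩)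
      invFun := fun x => ⟨(x.1.1, x.2.1), x.1.2, x.2.2⟩
      map_add' := fun _ _ => rfl
      map_smul' := fun _ _ => rfl
      left_inv := fun _ => rfl
      right_inv := fun _ => rfl }

lemma rank_dsum {b₁ a₁ b₂ a₂ : ℕ} (M₁ : Matrix (Fin b₁) (Fin a₁) ℂ)
    (M₂ : Matrix (Fin b₂) (Fin a₂) ℂ) : (dsum M₁ M₂).rank = M₁.rank + M₂.rank := by
  have h : (splitEquiv b₁ b₂).toLinearMap ∘ₗ (dsum M₁ M₂).mulVecLin =
      (M₁.mulVecLin.prodMap M₂.mulVecLin) ∘ₗ (splitEquiv a₁ a₂).toLinearMap :=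
    LinearMap.ext fun x => splitEquiv_dsum_mulVec M₁ M₂ x
  have h' := congrArg LinearMap.range h
  rw [LinearMap.range_comp, LinearMap.range_comp_of_range_eq_top _ (LinearEquiv.range _),
    LinearMap.range_prodMap] at h'
  rw [Matrix.rank, Matrix.rank, Matrix.rank, ← finrank_submodule_prod, ← h']
  exact (LinearEquiv.finrank_map_eq (splitEquiv b₁ b₂) _).symm

/-! ### Shift matrices and ranks of words in elementary pairs -/

/-- The `a × b` matrix with `1`s at the entries `(i + s, i)` and `0` elsewhere. -/
def shiftMat (s a b : ℕ) : Matrix (Fin a) (Fin b) ℂ :=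
  fun i j => if (i : ℕ) = (j : ℕ) + s then 1 else 0

lemma shiftMat_zero (a : ℕ) : shiftMat 0 a a = 1 := by
  ext i j
  simp [shiftMat, Matrix.one_apply, Fin.ext_iff]

lemma shiftMat_mul {s t a b c : ℕ} (h : ∀ k < c, k + t + s < a → k + t < b) :
    shiftMat s a b * shiftMat t b c = shiftMat (t + s) a c := by
  ext i k
  simp only [Matrix.mul_apply, shiftMat]
  by_cases hb : (k : ℕ) + t < b
  · rw [Finset.sum_eq_single (⟨k + t, hb⟩ : Fin b)]
    · simp [add_assoc]
    · intro j _ hj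
      rw [if_neg (fun h' => hj (Fin.ext h') : ¬ (j : ℕ) = k + t), mul_zero]
    · simp
  · rw [if_neg]
    · refine Finset.sum_eq_zero fun j _ => ?_
      rw [if_neg (by omega : ¬ (j : ℕ) = k + t), mul_zero]
    · intro h'
      exact hb (h k k.2 (by omega))

lemma shiftMat_one_pow (a i : ℕ) : shiftMat 1 a a ^ i = shiftMat i a a := by
  induction i with
  | zero => rw [pow_zero, shiftMat_zero]
  | succ i ih => rw [pow_succ', ih, shiftMat_mul (by omega)]

lemma rank_shiftMat (s a b : ℕ) : (shiftMat s a b).rank = min (a - s) b := by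
  apply le_antisymm
  · rw [show shiftMat s a b = shiftMat s a (min (a - s) b) * shiftMat 0 (min (a - s) b) b by
      rw [shiftMat_mul (by omega), zero_add]]
    exact (Matrix.rank_mul_le_left _ _).trans (Matrix.rank_le_width _)
  · have h : (shiftMat s a b).submatrix
        (fun i : Fin (min (a - s) b) => (⟨i + s, by omega⟩ : Fin a))
        (fun i : Fin (min (a - s) b) => (⟨i, by omega⟩ : Fin b)) = 1 := by
      ext i j
      simp [shiftMat, Matrix.one_apply, Fin.ext_iff]
    have hle := Matrix.rank_submatrix_le (shiftMat s a b)
        (fun i : Fin (min (a - s) b) => (⟨i + s, by omega⟩ : Fin a))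
        (fun i : Fin (min (a - s) b) => (⟨i, by omega⟩ : Fin b))
    rwa [h, Matrix.rank_one, Fintype.card_fin] at hle

/-- The ranks of `(B A)ⁱ`, `A (B A)ⁱ`, `(A B)ⁱ` and `B (A B)ⁱ`. -/
noncomputable def wordRank {m n : ℕ} (A : Matrix (Fin n) (Fin m) ℂ) (B : Matrix (Fin m) (Fin n) ℂ)
    (i : ℕ) : Fin 4 → ℕ :=
  ![((B * A) ^ i).rank, (A * (B * A) ^ i).rank, ((A * B) ^ i).rank, (B * (A * B) ^ i).rank]

lemma wordRank_dsum {m n m' n' : ℕ} (A : Matrix (Fin n) (Fin m) ℂ) (B : Matrix (Fin m) (Fin n) ℂ)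
    (A' : Matrix (Fin n') (Fin m') ℂ) (B' : Matrix (Fin m') (Fin n') ℂ) (i : ℕ) :
    wordRank (dsum A A') (dsum B B') i = wordRank A B i + wordRank A' B' i := by
  simp [wordRank, dsum_mul, dsum_pow, rank_dsum]

lemma wordRank_nil : wordRank (listA []) (listB []) = fun _ => 0 := by
  have h : ∀ M : Matrix (Fin 0) (Fin 0) ℂ, M.rank = 0 := fun M =>
    Nat.le_zero.mp (Matrix.rank_le_width M)
  ext i k
  fin_cases k <;> exact h _

lemma wordRank_castMat {a b m n : ℕ} (ha : a = m) (hb : b = n) (A : Matrix (Fin b) (Fin a) ℂ)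
    (B : Matrix (Fin a) (Fin b) ℂ) : wordRank (castMat hb ha A) (castMat ha hb B) = wordRank A B := by
  subst ha hb
  rfl

lemma rank_units_conj {m n : ℕ} (g : GL (Fin m) ℂ) (h : GL (Fin n) ℂ)
    (M : Matrix (Fin n) (Fin m) ℂ) : (h.1 * M * g⁻¹.1).rank = M.rank := by
  rw [Matrix.rank_mul_eq_left_of_isUnit_det, Matrix.rank_mul_eq_right_of_isUnit_det]
  · exact (Matrix.isUnit_iff_isUnit_det _).mp h.isUnit
  · exact (Matrix.isUnit_iff_isUnit_det _).mp g⁻¹.isUnit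

lemma units_conj_mul {k m n : ℕ} (f : GL (Fin k) ℂ) (g : GL (Fin m) ℂ) (h : GL (Fin n) ℂ)
    (M : Matrix (Fin k) (Fin m) ℂ) (N : Matrix (Fin m) (Fin n) ℂ) :
    (f.1 * M * g⁻¹.1) * (g.1 * N * h⁻¹.1) = f.1 * (M * N) * h⁻¹.1 := by
  have hg : g⁻¹.1 * (g.1 * (N * h⁻¹.1)) = N * h⁻¹.1 := by
    rw [← Matrix.mul_assoc, Units.inv_mul, Matrix.one_mul]
  simp only [Matrix.mul_assoc, hg]

lemma SameOrbit.wordRank_eq {m n : ℕ} {A A' : Matrix (Fin n) (Fin m) ℂ}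
    {B B' : Matrix (Fin m) (Fin n) ℂ} (h : SameOrbit m n A B A' B') :
    wordRank A' B' = wordRank A B := by
  obtain ⟨g, h, rfl, rfl⟩ := h
  funext i
  simp only [wordRank, units_conj_mul, Units.conj_pow, rank_units_conj]

lemma wordRank_shiftMat {s t a b : ℕ} (hst : s + t = 1) (hab : a ≤ b + t) (hba : b ≤ a + s) (i : ℕ) :
    wordRank (shiftMat s b a) (shiftMat t a b) i =
      ![a - i, min (b - (i + s)) a, b - i, min (a - (i + t)) b] := by
  have hts : t + s = 1 := by omega
  rw [wordRank, shiftMat_mul (by omega), shiftMat_mul (by omega), hst, hts, shiftMat_one_pow,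
    shiftMat_one_pow, shiftMat_mul (by omega), shiftMat_mul (by omega)]
  simp [rank_shiftMat]

lemma wordRank_elem (p : DPair) (i : ℕ) :
    wordRank (elemA p) (elemB p) i = match p with
      | .AB j => ![j + 1 - i, min (j - i) (j + 1), j - i, min (j + 1 - (i + 1)) j]
      | .BA j => ![j - i, min (j + 1 - (i + 1)) j, j + 1 - i, min (j - i) (j + 1)]
      | .P j => ![j + 1 - i, min (j + 1 - i) (j + 1), j + 1 - i, min (j + 1 - (i + 1)) (j + 1)]
      | .M j => ![j + 1 - i, min (j + 1 - (i + 1)) (j + 1), j + 1 - i, min (j + 1 - i) (j + 1)] := by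
  cases p with
  | AB j => exact wordRank_shiftMat (s := 0) (t := 1) (a := j + 1) (b := j) rfl le_rfl (by omega) i
  | BA j => exact wordRank_shiftMat (s := 1) (t := 0) (a := j) (b := j + 1) rfl (by omega) le_rfl i
  | P j =>
    exact wordRank_shiftMat (s := 0) (t := 1) (a := j + 1) (b := j + 1) rfl (by omega) le_rfl i
  | M j =>
    exact wordRank_shiftMat (s := 1) (t := 0) (a := j + 1) (b := j + 1) rfl le_rfl (by omega) i

/-- The combination of word ranks which counts the copies of an elementary pair. -/
def multFun (w : ℕ → Fin 4 → ℕ) : DPair → ℤ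
  | .AB j => w j 0 - w j 1 - w j 3 + w (j + 1) 2
  | .BA j => w j 2 - w j 3 - w j 1 + w (j + 1) 0
  | .P j => w j 1 - w (j + 1) 0 - w (j + 1) 2 + w (j + 1) 3
  | .M j => w j 3 - w (j + 1) 2 - w (j + 1) 0 + w (j + 1) 1

lemma multFun_add (w w' : ℕ → Fin 4 → ℕ) (q : DPair) :
    multFun (fun i => w i + w' i) q = multFun w q + multFun w' q := by
  cases q <;> simp only [multFun, Pi.add_apply, Nat.cast_add] <;> ring

lemma multFun_wordRank_elem (p q : DPair) :
    multFun (wordRank (elemA p) (elemB p)) q = if p = q then 1 else 0 := by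
  cases p <;> cases q <;>
  simp only [multFun, wordRank_elem, Matrix.cons_val, reduceCtorEq, if_false,
    DPair.AB.injEq, DPair.BA.injEq, DPair.P.injEq, DPair.M.injEq] <;>
  (try split_ifs) <;> omega

lemma multFun_wordRank_list (l : List DPair) (q : DPair) :
    multFun (wordRank (listA l) (listB l)) q = l.count q := by
  induction l with
  | nil =>
    rw [wordRank_nil]
    cases q <;> simp [multFun]
  | cons p t ih =>
    have h : wordRank (listA (p :: t)) (listB (p :: t)) =
        fun i => wordRank (elemA p) (elemB p) i + wordRank (listA t) (listB t) i :=
      funext fun i => wordRank_dsum _ _ _ _ i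
    rw [h, multFun_add, ih, multFun_wordRank_elem, List.count_cons]
    by_cases hpq : p = q <;> simp [hpq, add_comm]


lemma coe_eq_coe_of_sameOrbit {m n : ℕ} {l l' : List DPair} (ha : (l.map DPair.a).sum = m)
    (hb : (l.map DPair.b).sum = n) (ha' : (l'.map DPair.a).sum = m) (hb' : (l'.map DPair.b).sum = n)
    (h : SameOrbit m n (castMat hb ha (listA l)) (castMat ha hb (listB l))
      (castMat hb' ha' (listA l')) (castMat ha' hb' (listB l'))) :
    (l : Multiset DPair) = (l' : Multiset DPair) := by
  have hw := h.wordRank_eq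
  rw [wordRank_castMat, wordRank_castMat] at hw
  refine Multiset.coe_eq_coe.mpr (List.perm_iff_count.mpr fun q => ?_)
  have hq := multFun_wordRank_list l q
  rw [← hw, multFun_wordRank_list] at hq
  exact_mod_cast hq.symm

/-! ### Isomorphism of pairs of linear maps -/

section PairEquiv

variable {U W U' W' U'' W'' : Type*}
  [AddCommGroup U''] [Module ℂ U''] [AddCommGroup W''] [Module ℂ W'']
  [AddCommGroup U'] [Module ℂ U'] [AddCommGroup W'] [Module ℂ W']
  [AddCommGroup U] [Module ℂ U] [AddCommGroup W] [Module ℂ W]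

/-- Two pairs of linear maps in opposite directions are isomorphic. -/
def PairEquiv (A : U →ₗ[ℂ] W) (B : W →ₗ[ℂ] U) (A' : U' →ₗ[ℂ] W') (B' : W' →ₗ[ℂ] U') : Prop :=
  ∃ (e : U ≃ₗ[ℂ] U') (f : W ≃ₗ[ℂ] W'), (∀ x, f (A x) = A' (e x)) ∧ ∀ y, e (B y) = B' (f y)

variable {A : U →ₗ[ℂ] W} {B : W →ₗ[ℂ] U} {A' : U' →ₗ[ℂ] W'} {B' : W' →ₗ[ℂ] U'}
  {A'' : U'' →ₗ[ℂ] W''} {B'' : W'' →ₗ[ℂ] U''}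

lemma PairEquiv.refl (A : U →ₗ[ℂ] W) (B : W →ₗ[ℂ] U) : PairEquiv A B A B :=
  ⟨.refl ℂ U, .refl ℂ W, fun _ => rfl, fun _ => rfl⟩

lemma PairEquiv.symm (h : PairEquiv A B A' B') : PairEquiv A' B' A B := by
  obtain ⟨e, f, hA, hB⟩ := h
  refine ⟨e.symm, f.symm, fun x => ?_, fun y => ?_⟩
  · rw [LinearEquiv.symm_apply_eq, hA, LinearEquiv.apply_symm_apply]
  · rw [LinearEquiv.symm_apply_eq, hB, LinearEquiv.apply_symm_apply]

lemma PairEquiv.trans (h : PairEquiv A B A' B') (h' : PairEquiv A' B' A'' B'') :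
    PairEquiv A B A'' B'' := by
  obtain ⟨e, f, hA, hB⟩ := h
  obtain ⟨e', f', hA', hB'⟩ := h'
  exact ⟨e.trans e', f.trans f', fun x => by simp [hA, hA'], fun y => by simp [hB, hB']⟩

lemma PairEquiv.swap (h : PairEquiv A B A' B') : PairEquiv B A B' A' := by
  obtain ⟨e, f, hA, hB⟩ := h
  exact ⟨f, e, hB, hA⟩

lemma PairEquiv.prodMap {X Y X' Y' : Type*}
    [AddCommGroup X] [Module ℂ X] [AddCommGroup Y] [Module ℂ Y]
    [AddCommGroup X'] [Module ℂ X'] [AddCommGroup Y'] [Module ℂ Y']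
    {C : X →ₗ[ℂ] Y} {D : Y →ₗ[ℂ] X} {C' : X' →ₗ[ℂ] Y'} {D' : Y' →ₗ[ℂ] X'}
    (h : PairEquiv A B A' B') (h' : PairEquiv C D C' D') :
    PairEquiv (A.prodMap C) (B.prodMap D) (A'.prodMap C') (B'.prodMap D') := by
  obtain ⟨e, f, hA, hB⟩ := h
  obtain ⟨e', f', hC, hD⟩ := h'
  exact ⟨e.prodCongr e', f.prodCongr f', fun x => by simp [hA, hC], fun y => by simp [hB, hD]⟩

lemma PairEquiv.prodMap_left_comm :
    PairEquiv (A.prodMap (A'.prodMap A'')) (B.prodMap (B'.prodMap B''))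
      (A'.prodMap (A.prodMap A'')) (B'.prodMap (B.prodMap B'')) :=
  ⟨((LinearEquiv.prodAssoc ℂ U U' U'').symm.trans
      ((LinearEquiv.prodComm ℂ U U').prodCongr (.refl ℂ U''))).trans
      (LinearEquiv.prodAssoc ℂ U' U U''),
    ((LinearEquiv.prodAssoc ℂ W W' W'').symm.trans
      ((LinearEquiv.prodComm ℂ W W').prodCongr (.refl ℂ W''))).trans
      (LinearEquiv.prodAssoc ℂ W' W W''), fun _ => rfl, fun _ => rfl⟩

lemma pairEquiv_dsum {m n m' n' : ℕ} (A : Matrix (Fin n) (Fin m) ℂ) (B : Matrix (Fin m) (Fin n) ℂ)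
    (A' : Matrix (Fin n') (Fin m') ℂ) (B' : Matrix (Fin m') (Fin n') ℂ) :
    PairEquiv (dsum A A').mulVecLin (dsum B B').mulVecLin
      (A.mulVecLin.prodMap A'.mulVecLin) (B.mulVecLin.prodMap B'.mulVecLin) :=
  ⟨splitEquiv m m', splitEquiv n n', splitEquiv_dsum_mulVec A A', splitEquiv_dsum_mulVec B B'⟩

lemma pairEquiv_list_cons (p : DPair) (l : List DPair) :
    PairEquiv (listA (p :: l)).mulVecLin (listB (p :: l)).mulVecLin
      ((elemA p).mulVecLin.prodMap (listA l).mulVecLin)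
      ((elemB p).mulVecLin.prodMap (listB l).mulVecLin) :=
  pairEquiv_dsum _ _ _ _

lemma pairEquiv_list_of_perm {l l' : List DPair} (h : l.Perm l') :
    PairEquiv (listA l).mulVecLin (listB l).mulVecLin (listA l').mulVecLin
      (listB l').mulVecLin := by
  induction h with
  | nil => exact .refl _ _
  | cons p _ ih =>
    exact (pairEquiv_list_cons p _).trans
      ((PairEquiv.prodMap (.refl _ _) ih).trans (pairEquiv_list_cons p _).symm)
  | swap p q l =>
    have h (p q : DPair) := (pairEquiv_list_cons p (q :: l)).trans
      (PairEquiv.prodMap (.refl _ _) (pairEquiv_list_cons q l))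
    exact (h q p).trans (PairEquiv.prodMap_left_comm.trans (h p q).symm)
  | trans _ _ ih₁ ih₂ => exact ih₁.trans ih₂

/-- The invertible matrix of a linear automorphism of a coordinate space. -/
noncomputable def glOfEquiv {m : ℕ} (e : (Fin m → ℂ) ≃ₗ[ℂ] (Fin m → ℂ)) : GL (Fin m) ℂ where
  val := e.toLinearMap.toMatrix'
  inv := e.symm.toLinearMap.toMatrix'
  val_inv := by rw [← LinearMap.toMatrix'_comp]; simp
  inv_val := by rw [← LinearMap.toMatrix'_comp]; simp

lemma sameOrbit_of_pairEquiv {m n : ℕ} {A A' : Matrix (Fin n) (Fin m) ℂ}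
    {B B' : Matrix (Fin m) (Fin n) ℂ}
    (h : PairEquiv A.mulVecLin B.mulVecLin A'.mulVecLin B'.mulVecLin) :
    SameOrbit m n A B A' B' := by
  obtain ⟨e, f, hA, hB⟩ := h
  have key : ∀ {k l : ℕ} {M M' : Matrix (Fin k) (Fin l) ℂ} (e : (Fin l → ℂ) ≃ₗ[ℂ] (Fin l → ℂ))
      (f : (Fin k → ℂ) ≃ₗ[ℂ] (Fin k → ℂ)), (∀ x, f (M.mulVecLin x) = M'.mulVecLin (e x)) →
      M' = (glOfEquiv f).1 * M * (glOfEquiv e)⁻¹.1 := by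
    intro k l M M' e f h
    have h' : f.toLinearMap ∘ₗ M.toLin' = M'.toLin' ∘ₗ e.toLinearMap := LinearMap.ext h
    have h'' := congrArg LinearMap.toMatrix' h'
    rw [LinearMap.toMatrix'_comp, LinearMap.toMatrix'_comp, LinearMap.toMatrix'_toLin',
      LinearMap.toMatrix'_toLin'] at h''
    change (glOfEquiv f).1 * M = M' * (glOfEquiv e).1 at h''
    rw [h'', Matrix.mul_assoc, Units.mul_inv, Matrix.mul_one]
  exact ⟨glOfEquiv e, glOfEquiv f, key e f hA, key f e hB⟩

lemma sameOrbit_castMat_of_pairEquiv {a b a' b' m n : ℕ} (ha : a = m) (hb : b = n) (ha' : a' = m)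
    (hb' : b' = n) {A : Matrix (Fin b) (Fin a) ℂ} {B : Matrix (Fin a) (Fin b) ℂ}
    {A' : Matrix (Fin b') (Fin a') ℂ} {B' : Matrix (Fin a') (Fin b') ℂ}
    (h : PairEquiv A.mulVecLin B.mulVecLin A'.mulVecLin B'.mulVecLin) :
    SameOrbit m n (castMat hb ha A) (castMat ha hb B) (castMat hb' ha' A') (castMat ha' hb' B') := by
  subst ha hb ha' hb'
  exact sameOrbit_of_pairEquiv h

end PairEquiv

/-! ### Splitting off an elementary pair -/

lemma sum_shiftMat_mulVec_smul {V : Type*} [AddCommGroup V] [Module ℂ V] {s a b : ℕ} (v : ℕ → V)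
    (hv : ∀ k < a, b ≤ k + s → v (k + s) = 0) (c : Fin a → ℂ) :
    ∑ i : Fin b, (shiftMat s b a *ᵥ c) i • v i = ∑ k : Fin a, c k • v (k + s) := by
  simp only [Matrix.mulVec, dotProduct, shiftMat, Finset.sum_smul]
  rw [Finset.sum_comm]
  refine Finset.sum_congr rfl fun k _ => ?_
  by_cases hk : (k : ℕ) + s < b
  · rw [Finset.sum_eq_single (⟨k + s, hk⟩ : Fin b)]
    · simp
    · intro i _ hi
      rw [if_neg (fun h => hi (Fin.ext h)), zero_mul, zero_smul]
    · simp
  · rw [hv k k.2 (by omega), smul_zero]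
    refine Finset.sum_eq_zero fun i _ => ?_
    rw [if_neg (by omega), zero_mul, zero_smul]

lemma shiftMat_mulVec_apply {s a b : ℕ} (g : ℕ → ℂ) (i : Fin b) :
    (shiftMat s b a *ᵥ fun k => g k) i = if s ≤ i ∧ i - s < a then g (i - s) else 0 := by
  simp only [Matrix.mulVec, dotProduct, shiftMat]
  split_ifs with h
  · rw [Finset.sum_eq_single (⟨i - s, h.2⟩ : Fin a)]
    · rw [if_pos (by simp; omega), one_mul]
    · intro k _ hk
      rw [if_neg (fun h' => hk (Fin.ext (by simp; omega))), zero_mul]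
    · simp
  · refine Finset.sum_eq_zero fun k _ => ?_
    rw [if_neg (by omega), zero_mul]

lemma toeplitz_mulVec_injective {a j : ℕ} (ha : a ≤ j + 1) (h : ℕ → ℂ) (hj : h j ≠ 0)
    (hz : ∀ d, j < d → h d = 0) :
    Function.Injective (Matrix.of fun i k : Fin a => h (j - i + k)).mulVec := by
  rw [Matrix.mulVec_injective_iff_isUnit, Matrix.isUnit_iff_isUnit_det,
    Matrix.det_of_isLowerTriangular]
  · refine IsUnit.mk0 _ (Finset.prod_ne_zero_iff.mpr fun i _ => ?_)
    rw [Matrix.of_apply, show j - (i : ℕ) + i = j by omega]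
    exact hj
  · intro i k hik
    have : (i : ℕ) < k := by simpa using hik
    exact hz _ (by omega)

section Splitting

variable {U W S T : Type*} [AddCommGroup U] [Module ℂ U] [AddCommGroup W] [Module ℂ W]
  [AddCommGroup S] [Module ℂ S] [AddCommGroup T] [Module ℂ T]

/-- The pair `(A₀, B₀)` is a direct summand of `(A, B)`, with a nilpotent complement. -/
def HasSummand (A : U →ₗ[ℂ] W) (B : W →ₗ[ℂ] U) (A₀ : S →ₗ[ℂ] T) (B₀ : T →ₗ[ℂ] S) : Prop :=
  ∃ (K : Submodule ℂ U) (L : Submodule ℂ W) (A' : K →ₗ[ℂ] L) (B' : L →ₗ[ℂ] K),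
    IsNilpotent (B' ∘ₗ A' : Module.End ℂ K) ∧
      PairEquiv A B (A₀.prodMap A') (B₀.prodMap B')

lemma map_pow_comp (A : U →ₗ[ℂ] W) (B : W →ₗ[ℂ] U) (i : ℕ) (x : U) :
    A (((B ∘ₗ A : Module.End ℂ U) ^ i) x) = ((A ∘ₗ B : Module.End ℂ W) ^ i) (A x) := by
  induction i generalizing x with
  | zero => rfl
  | succ i ih => simp only [pow_succ, Module.End.mul_apply, ih, LinearMap.comp_apply]

lemma isNilpotent_comp_swap {A : U →ₗ[ℂ] W} {B : W →ₗ[ℂ] U}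
    (h : IsNilpotent (B ∘ₗ A : Module.End ℂ U)) : IsNilpotent (A ∘ₗ B : Module.End ℂ W) := by
  obtain ⟨k, hk⟩ := h
  refine ⟨k + 1, LinearMap.ext fun y => ?_⟩
  rw [pow_succ, Module.End.mul_apply, LinearMap.comp_apply, ← map_pow_comp, hk]
  simp

lemma HasSummand.swap {A : U →ₗ[ℂ] W} {B : W →ₗ[ℂ] U} {A₀ : S →ₗ[ℂ] T} {B₀ : T →ₗ[ℂ] S}
    (h : HasSummand A B A₀ B₀) : HasSummand B A B₀ A₀ := by
  obtain ⟨K, L, A', B', hnil, h⟩ := h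
  exact ⟨L, K, B', A', isNilpotent_comp_swap hnil, h.swap⟩

/-- If `ψ ∘ φ` is injective, then the range of `φ` is a complement of the kernel of `ψ`. -/
noncomputable def prodKerEquiv [FiniteDimensional ℂ S] (φ : S →ₗ[ℂ] U) (ψ : U →ₗ[ℂ] S)
    (h : Function.Injective (ψ ∘ₗ φ)) : (S × LinearMap.ker ψ) ≃ₗ[ℂ] U :=
  LinearEquiv.ofBijective (φ.coprod (LinearMap.ker ψ).subtype) <| by
    constructor
    · rw [injective_iff_map_eq_zero]
      rintro ⟨s, k⟩ hs
      have hs' : φ s + k = 0 := by simpa using hs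
      have hψ := congrArg ψ hs'
      rw [map_add, LinearMap.mem_ker.mp k.2, add_zero, map_zero] at hψ
      have h0 : s = 0 := h (by simpa using hψ)
      subst h0
      ext
      · rfl
      · simpa using hs'
    · intro x
      obtain ⟨s, hs⟩ := LinearMap.injective_iff_surjective.mp h (ψ x)
      refine ⟨(s, ⟨x - φ s, ?_⟩), by simp⟩
      rw [LinearMap.mem_ker, map_sub, ← hs, LinearMap.comp_apply, sub_self]

lemma prodKerEquiv_apply [FiniteDimensional ℂ S] (φ : S →ₗ[ℂ] U) (ψ : U →ₗ[ℂ] S)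
    (h : Function.Injective (ψ ∘ₗ φ)) (x : S × LinearMap.ker ψ) :
    prodKerEquiv φ ψ h x = φ x.1 + x.2 := rfl

lemma hasSummand_of_injective [FiniteDimensional ℂ S] [FiniteDimensional ℂ T]
    {A : U →ₗ[ℂ] W} {B : W →ₗ[ℂ] U} {A₀ : S →ₗ[ℂ] T} {B₀ : T →ₗ[ℂ] S}
    (hnil : IsNilpotent (B ∘ₗ A : Module.End ℂ U))
    (φ : S →ₗ[ℂ] U) (φ' : T →ₗ[ℂ] W) (ψ : U →ₗ[ℂ] S) (ψ' : W →ₗ[ℂ] T)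
    (hφA : ∀ s, A (φ s) = φ' (A₀ s)) (hφB : ∀ t, B (φ' t) = φ (B₀ t))
    (hψA : ∀ x, ψ' (A x) = A₀ (ψ x)) (hψB : ∀ y, ψ (B y) = B₀ (ψ' y))
    (h : Function.Injective (ψ ∘ₗ φ)) (h' : Function.Injective (ψ' ∘ₗ φ')) :
    HasSummand A B A₀ B₀ := by
  have hA : ∀ x ∈ LinearMap.ker ψ, A x ∈ LinearMap.ker ψ' := fun x hx => by
    rw [LinearMap.mem_ker, hψA, LinearMap.mem_ker.mp hx, map_zero]
  have hB : ∀ y ∈ LinearMap.ker ψ', B y ∈ LinearMap.ker ψ := fun y hy => by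
    rw [LinearMap.mem_ker, hψB, LinearMap.mem_ker.mp hy, map_zero]
  refine ⟨LinearMap.ker ψ, LinearMap.ker ψ', A.restrict hA, B.restrict hB, ?_, PairEquiv.symm
    ⟨prodKerEquiv φ ψ h, prodKerEquiv φ' ψ' h', fun x => ?_, fun y => ?_⟩⟩
  · obtain ⟨k, hk⟩ := hnil
    refine ⟨k, LinearMap.ext fun x => Subtype.ext ?_⟩
    have hpow : ∀ (i : ℕ) (x : LinearMap.ker ψ),
        (((B.restrict hB ∘ₗ A.restrict hA : Module.End ℂ (LinearMap.ker ψ)) ^ i) x : U) =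
          ((B ∘ₗ A : Module.End ℂ U) ^ i) x := by
      intro i
      induction i with
      | zero => intro x; rfl
      | succ i ih => intro x; rw [pow_succ, pow_succ, Module.End.mul_apply, ih]; rfl
    rw [hpow, hk]
    rfl
  · simp [prodKerEquiv_apply, hφA]
  · simp [prodKerEquiv_apply, hφB]

lemma hasSummand_shiftMat {j b : ℕ} (hjb : j ≤ b) (hbj : b ≤ j + 1)
    {A : U →ₗ[ℂ] W} {B : W →ₗ[ℂ] U} (hnil : IsNilpotent (B ∘ₗ A : Module.End ℂ U))
    (u : U) (α : ℕ → U →ₗ[ℂ] ℂ) (β : ℕ → W →ₗ[ℂ] ℂ)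
    (hα : ∀ d y, α d (B y) = β (d + 1) y) (hβ : ∀ d x, j < b + d → β d (A x) = α d x)
    (hβ₀ : β (j + 1) = 0) (hu : α j u ≠ 0)
    (huU : ((B ∘ₗ A : Module.End ℂ U) ^ (j + 1)) u = 0)
    (huW : A (((B ∘ₗ A : Module.End ℂ U) ^ b) u) = 0) :
    HasSummand A B (shiftMat 0 b (j + 1)).mulVecLin (shiftMat 1 (j + 1) b).mulVecLin := by
  set N : Module.End ℂ U := B ∘ₗ A with hN
  have hα_succ : ∀ d x, α (d + 1) x = α d (N x) := fun d x => by
    rw [hN, LinearMap.comp_apply, hα, hβ _ _ (by omega)]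
  have hα_pow : ∀ k d, α d ((N ^ k) u) = α (d + k) u := by
    intro k
    induction k with
    | zero => intro d; rfl
    | succ k ih => intro d; rw [pow_succ', Module.End.mul_apply, ← hα_succ, ih, add_right_comm,
        add_assoc]
  have hα_zero : ∀ d, j < d → α d u = 0 := by
    intro d hd
    obtain ⟨k, rfl⟩ := Nat.exists_eq_add_of_lt hd
    rw [show j + k + 1 = j + (k + 1) by ring, ← hα_pow, pow_succ', Module.End.mul_apply, hN,
      LinearMap.comp_apply, hα, hβ₀, LinearMap.zero_apply]
  have hN_zero : ∀ k, j < k → (N ^ k) u = 0 := by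
    intro k hk
    obtain ⟨i, rfl⟩ := Nat.exists_eq_add_of_lt hk
    rw [show j + i + 1 = i + (j + 1) by ring, pow_add, Module.End.mul_apply, huU, map_zero]
  refine hasSummand_of_injective hnil
    (Fintype.linearCombination ℂ fun k : Fin (j + 1) => (N ^ (k : ℕ)) u)
    (Fintype.linearCombination ℂ fun k : Fin b => A ((N ^ (k : ℕ)) u))
    (LinearMap.pi fun i : Fin (j + 1) => α (j - i)) (LinearMap.pi fun i : Fin b => β (j - i))
    (fun c => ?_) (fun c => ?_) (fun x => ?_) (fun y => ?_) ?_ ?_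
  · simp only [Fintype.linearCombination_apply, map_sum, map_smul, Matrix.mulVecLin_apply]
    refine (sum_shiftMat_mulVec_smul (s := 0) (fun k => A ((N ^ k) u)) (fun k hk hbk => ?_) c).symm
    obtain rfl | hk' : k = b ∨ j < k := by omega
    · exact huW
    · simp only [add_zero, hN_zero k hk', map_zero]
  · simp only [Fintype.linearCombination_apply, map_sum, map_smul, Matrix.mulVecLin_apply]
    refine Eq.trans ?_ (sum_shiftMat_mulVec_smul (s := 1) (fun k => (N ^ k) u)
      (fun k _ hk => hN_zero _ (by omega)) c).symm
    refine Finset.sum_congr rfl fun k _ => ?_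
    rw [pow_succ', Module.End.mul_apply, hN, LinearMap.comp_apply]
  · funext i
    refine Eq.trans ?_ (shiftMat_mulVec_apply (s := 0) (fun k => α (j - k) x) i).symm
    rw [if_pos (by omega)]
    exact hβ _ _ (by omega)
  · funext i
    refine Eq.trans ?_ (shiftMat_mulVec_apply (s := 1) (fun k => β (j - k) y) i).symm
    rw [LinearMap.pi_apply, hα]
    split_ifs with hi
    · congr 2
      omega
    · rw [show j - (i : ℕ) + 1 = j + 1 by omega, hβ₀, LinearMap.zero_apply]
  · convert! toeplitz_mulVec_injective le_rfl (fun d => α d u) hu hα_zero using 1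
    funext c i
    simp [Fintype.linearCombination_apply, Matrix.mulVec, dotProduct, hα_pow, mul_comm]
  · convert! toeplitz_mulVec_injective hbj (fun d => α d u) hu hα_zero using 1
    funext c i
    have hi : j < b + (j - i) := by omega
    simp [Fintype.linearCombination_apply, Matrix.mulVec, dotProduct, hα_pow, mul_comm,
      hβ _ _ hi]

lemma exists_dual_apply_ne_zero {x : U} (hx : x ≠ 0) : ∃ φ : U →ₗ[ℂ] ℂ, φ x ≠ 0 := by
  by_contra! h
  exact hx ((Module.forall_dual_apply_eq_zero_iff ℂ x).mp h)

lemma hasSummand_AB {j : ℕ} {A : U →ₗ[ℂ] W} {B : W →ₗ[ℂ] U}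
    (hnil : IsNilpotent (B ∘ₗ A : Module.End ℂ U))
    (hA : ∀ x, A (((B ∘ₗ A : Module.End ℂ U) ^ j) x) = 0)
    (hB : ∀ y, B (((A ∘ₗ B : Module.End ℂ W) ^ j) y) = 0)
    {u : U} (hu : ((B ∘ₗ A : Module.End ℂ U) ^ j) u ≠ 0) :
    HasSummand A B (elemA (.AB j)).mulVecLin (elemB (.AB j)).mulVecLin := by
  obtain ⟨φ, hφ⟩ := exists_dual_apply_ne_zero hu
  refine hasSummand_shiftMat (j := j) (b := j) le_rfl (by omega) hnil u
    (fun d => φ ∘ₗ (B ∘ₗ A : Module.End ℂ U) ^ d)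
    (fun d => d.casesOn 0 fun d => φ ∘ₗ ((B ∘ₗ A : Module.End ℂ U) ^ d) ∘ₗ B)
    (fun d y => rfl) (fun d x hd => ?_) (LinearMap.ext fun y => ?_) hφ ?_ (hA u)
  · obtain ⟨d, rfl⟩ := Nat.exists_eq_succ_of_ne_zero (show d ≠ 0 by omega)
    simp only [LinearMap.comp_apply, Nat.succ_eq_add_one, pow_succ, Module.End.mul_apply]
  · simp only [LinearMap.comp_apply, ← map_pow_comp, hB, map_zero, LinearMap.zero_apply]
  · rw [pow_succ', Module.End.mul_apply, LinearMap.comp_apply, hA, map_zero]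

lemma hasSummand_P {j : ℕ} {A : U →ₗ[ℂ] W} {B : W →ₗ[ℂ] U}
    (hBA : (B ∘ₗ A : Module.End ℂ U) ^ (j + 1) = 0) (hAB : (A ∘ₗ B : Module.End ℂ W) ^ (j + 1) = 0)
    {u : U} (hu : A (((B ∘ₗ A : Module.End ℂ U) ^ j) u) ≠ 0) :
    HasSummand A B (elemA (.P j)).mulVecLin (elemB (.P j)).mulVecLin := by
  obtain ⟨φ, hφ⟩ := exists_dual_apply_ne_zero hu
  refine hasSummand_shiftMat (j := j) (b := j + 1) (by omega) le_rfl ⟨_, hBA⟩ u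
    (fun d => φ ∘ₗ A ∘ₗ ((B ∘ₗ A : Module.End ℂ U) ^ d))
    (fun d => φ ∘ₗ ((A ∘ₗ B : Module.End ℂ W) ^ d))
    (fun d y => ?_) (fun d x _ => ?_) ?_ hφ ?_ ?_
  · simp only [LinearMap.comp_apply, map_pow_comp, pow_succ, Module.End.mul_apply]
  · simp only [LinearMap.comp_apply, map_pow_comp]
  · simp only [hAB, LinearMap.comp_zero]
  · rw [hBA, LinearMap.zero_apply]
  · rw [hBA, LinearMap.zero_apply, map_zero]

lemma exists_hasSummand {A : U →ₗ[ℂ] W} {B : W →ₗ[ℂ] U} (hUW : Nontrivial U ∨ Nontrivial W)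
    (hnil : IsNilpotent (B ∘ₗ A : Module.End ℂ U)) :
    ∃ p : DPair, HasSummand A B (elemA p).mulVecLin (elemB p).mulVecLin := by
  classical
  have hnil' := isNilpotent_comp_swap hnil
  have hex : ∃ i, (B ∘ₗ A : Module.End ℂ U) ^ i = 0 ∧ (A ∘ₗ B : Module.End ℂ W) ^ i = 0 := by
    obtain ⟨k, hk⟩ := hnil
    obtain ⟨k', hk'⟩ := hnil'
    exact ⟨k + k', by rw [pow_add, hk, zero_mul], by rw [pow_add, hk', mul_zero]⟩
  obtain ⟨hBA, hAB⟩ := Nat.find_spec hex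
  have hmin := fun i => Nat.find_min hex (m := i)
  generalize Nat.find hex = i at hBA hAB hmin
  obtain _ | j := i
  · rcases hUW with h | h
    · exact absurd hBA one_ne_zero
    · exact absurd hAB one_ne_zero
  by_cases hA : ∀ x, A (((B ∘ₗ A : Module.End ℂ U) ^ j) x) = 0
  · by_cases hB : ∀ y, B (((A ∘ₗ B : Module.End ℂ W) ^ j) y) = 0
    · by_cases hT : ∀ u, ((B ∘ₗ A : Module.End ℂ U) ^ j) u = 0
      · have hS : ∃ w, ((A ∘ₗ B : Module.End ℂ W) ^ j) w ≠ 0 := by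
          by_contra! hS
          exact hmin j (Nat.lt_succ_self j) ⟨LinearMap.ext hT, LinearMap.ext hS⟩
        obtain ⟨w, hw⟩ := hS
        exact ⟨.BA j, (hasSummand_AB hnil' hB hA hw).swap⟩
      · obtain ⟨u, hu⟩ := not_forall.mp hT
        exact ⟨.AB j, hasSummand_AB hnil hA hB hu⟩
    · obtain ⟨w, hw⟩ := not_forall.mp hB
      exact ⟨.M j, (hasSummand_P hAB hBA hw).swap⟩
  · obtain ⟨u, hu⟩ := not_forall.mp hA
    exact ⟨.P j, hasSummand_P hBA hAB hu⟩

end Splitting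

lemma exists_pairEquiv_list (d : ℕ) : ∀ (U W : Type) [AddCommGroup U] [Module ℂ U] [AddCommGroup W]
    [Module ℂ W] [FiniteDimensional ℂ U] [FiniteDimensional ℂ W] (A : U →ₗ[ℂ] W) (B : W →ₗ[ℂ] U),
    Module.finrank ℂ U + Module.finrank ℂ W = d → IsNilpotent (B ∘ₗ A : Module.End ℂ U) →
    ∃ l : List DPair, PairEquiv A B (listA l).mulVecLin (listB l).mulVecLin := by
  induction d using Nat.strong_induction_on with
  | _ d ih =>
    intro U W _ _ _ _ _ _ A B hd hnil
    by_cases hUW : Nontrivial U ∨ Nontrivial W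
    · obtain ⟨p, K, L, A', B', hnil', h⟩ := exists_hasSummand hUW hnil
      have hlt : Module.finrank ℂ K + Module.finrank ℂ L < d := by
        obtain ⟨e, f, -, -⟩ := h
        have he := e.finrank_eq
        have hf := f.finrank_eq
        rw [Module.finrank_prod, Module.finrank_fin_fun] at he hf
        have hp : 0 < p.a + p.b := by cases p <;> simp [DPair.a, DPair.b]
        omega
      obtain ⟨l, hl⟩ := ih _ hlt K L A' B' rfl hnil'
      exact ⟨p :: l, h.trans ((PairEquiv.prodMap (.refl _ _) hl).trans
        (pairEquiv_list_cons p l).symm)⟩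
    · rw [not_or, not_nontrivial_iff_subsingleton, not_nontrivial_iff_subsingleton] at hUW
      obtain ⟨_, _⟩ := hUW
      have : Subsingleton (Fin (([] : List DPair).map DPair.a).sum → ℂ) :=
        inferInstanceAs (Subsingleton (Fin 0 → ℂ))
      have : Subsingleton (Fin (([] : List DPair).map DPair.b).sum → ℂ) :=
        inferInstanceAs (Subsingleton (Fin 0 → ℂ))
      exact ⟨[], 0, 0, fun _ => Subsingleton.elim _ _, fun _ => Subsingleton.elim _ _⟩

/-- Kraft–Procesi classification: every pair `(A, B)` with `B A` nilpotent can be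
conjugated into the direct sum of the elementary pairs attached to a decorated
bipartition `γ ∈ DP(m,n)` (represented by a list `l` with the correct coordinate sums);
the decorated bipartition is uniquely determined by, and determines, the orbit. -/
theorem nilpotent_pairs_classified_by_DP (m n : ℕ)
    (A : Matrix (Fin n) (Fin m) ℂ) (B : Matrix (Fin m) (Fin n) ℂ)
    (hnil : IsNilpotent (B * A)) :
    (∃ (l : List DPair) (ha : (l.map DPair.a).sum = m) (hb : (l.map DPair.b).sum = n),
      SameOrbit m n A B (castMat hb ha (listA l)) (castMat ha hb (listB l))) ∧
    (∀ (l l' : List DPair) (ha : (l.map DPair.a).sum = m) (hb : (l.map DPair.b).sum = n)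
      (ha' : (l'.map DPair.a).sum = m) (hb' : (l'.map DPair.b).sum = n),
      SameOrbit m n (castMat hb ha (listA l)) (castMat ha hb (listB l))
          (castMat hb' ha' (listA l')) (castMat ha' hb' (listB l')) →
        (l : Multiset DPair) = (l' : Multiset DPair)) ∧
    (∀ (l l' : List DPair) (ha : (l.map DPair.a).sum = m) (hb : (l.map DPair.b).sum = n)
      (ha' : (l'.map DPair.a).sum = m) (hb' : (l'.map DPair.b).sum = n),
      (l : Multiset DPair) = (l' : Multiset DPair) →
        SameOrbit m n (castMat hb ha (listA l)) (castMat ha hb (listB l))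
          (castMat hb' ha' (listA l')) (castMat ha' hb' (listB l'))) := by
  refine ⟨?_, fun l l' ha hb ha' hb' h => coe_eq_coe_of_sameOrbit ha hb ha' hb' h,
    fun l l' ha hb ha' hb' h => sameOrbit_castMat_of_pairEquiv ha hb ha' hb'
      (pairEquiv_list_of_perm (Multiset.coe_eq_coe.mp h))⟩
  have hnil' : IsNilpotent (B.mulVecLin ∘ₗ A.mulVecLin : Module.End ℂ (Fin m → ℂ)) := by
    rw [← Matrix.mulVecLin_mul]
    exact hnil.map (Matrix.toLinAlgEquiv' : Matrix (Fin m) (Fin m) ℂ ≃ₐ[ℂ] _)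
  obtain ⟨l, h⟩ := exists_pairEquiv_list _ _ _ A.mulVecLin B.mulVecLin rfl hnil'
  have hab : (l.map DPair.a).sum = m ∧ (l.map DPair.b).sum = n := by
    obtain ⟨e, f, -, -⟩ := h
    have he := e.finrank_eq
    have hf := f.finrank_eq
    rw [Module.finrank_fin_fun, Module.finrank_fin_fun] at he hf
    exact ⟨he.symm, hf.symm⟩
  exact ⟨l, hab.1, hab.2, sameOrbit_castMat_of_pairEquiv rfl rfl hab.1 hab.2 h⟩
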